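/- Let 𝒜 be a MAD family on a set X of cardinality ℵ₁, and let {𝒜₁, 𝒜₂} be a partition of 𝒜 such that 𝒜₁ is nowhere MAD on X and |𝒜₁| = ℵ₁. Then there exists A ∈ 𝒜₁ such that A ∩ (⋃𝒜₂) has cardinality ℵ₁. -/

import Mathlib

open Cardinal Set TopologicalSpace

/-- A P-space: the intersection of every countable family of open sets is open. -/
def IsPSpace (X : Type*) [TopologicalSpace X] : Prop :=
  ∀ S : Set (Set X), S.Countable → (∀ s ∈ S, IsOpen s) → IsOpen (⋂₀ S)

/-- Whyburn: for every non-closed `A` and every `x ∈ closure A \ A` there is an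
almost closed `F ⊆ A` converging to `x`. -/
def IsWhyburn (X : Type*) [TopologicalSpace X] : Prop :=
  ∀ A : Set X, ¬ IsClosed A → ∀ x ∈ closure A \ A, ∃ F ⊆ A, closure F \ F = {x}

/-- Weakly Whyburn: for every non-closed `A` there are `x ∈ closure A \ A` and an
almost closed `F ⊆ A` converging to `x`. -/
def IsWeaklyWhyburn (X : Type*) [TopologicalSpace X] : Prop :=
  ∀ A : Set X, ¬ IsClosed A → ∃ x ∈ closure A \ A, ∃ F ⊆ A, closure F \ F = {x}
/-- `ADOn X 𝒜`: `𝒜` is an almost disjoint family on the set `X`: a family of subsets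
of `X` of cardinality ℵ₁, any two distinct members of which have intersection of
cardinality less than ℵ₁. -/
def ADOn {S : Type*} (X : Set S) (𝒜 : Set (Set S)) : Prop :=
  (∀ A ∈ 𝒜, A ⊆ X ∧ Cardinal.mk A = Cardinal.aleph 1) ∧
  (∀ A ∈ 𝒜, ∀ B ∈ 𝒜, A ≠ B → Cardinal.mk (↥(A ∩ B)) < Cardinal.aleph 1)

/-- `MADOn X 𝒜`: `𝒜` is a maximal almost disjoint family on the set `X`. -/
def MADOn {S : Type*} (X : Set S) (𝒜 : Set (Set S)) : Prop :=
  ADOn X 𝒜 ∧ ∀ ℬ : Set (Set S), ADOn X ℬ → 𝒜 ⊆ ℬ → ℬ = 𝒜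

/-- The trace of the family `𝒜` on a set `X`: `{X ∩ p : p ∈ 𝒜, X ∩ p uncountable}`. -/
def traceFam {S : Type*} (𝒜 : Set (Set S)) (X : Set S) : Set (Set S) :=
  {Y | ∃ p ∈ 𝒜, ¬ (X ∩ p).Countable ∧ Y = X ∩ p}

/-- `X ∈ I(𝒜)`: there is a countable subfamily `ℱ ⊆ 𝒜` with `X \ ⋃ℱ` countable. -/
def InIdeal {S : Type*} (𝒜 : Set (Set S)) (X : Set S) : Prop :=
  ∃ ℱ ⊆ 𝒜, ℱ.Countable ∧ (X \ ⋃₀ ℱ).Countable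

/-- `𝒜` is nowhere MAD on `X`: every uncountable `Y ⊆ X` on which the trace of `𝒜`
is a MAD family belongs to `I(𝒜)`. -/
def NowhereMADOn {S : Type*} (X : Set S) (𝒜 : Set (Set S)) : Prop :=
  ∀ Y ⊆ X, ¬ Y.Countable → MADOn Y (traceFam 𝒜 Y) → InIdeal 𝒜 Y

theorem countable_iff_mk_lt_aleph_one {S : Type*} (A : Set S) :
    A.Countable ↔ Cardinal.mk A < Cardinal.aleph 1 := by
  rw [← Cardinal.le_aleph0_iff_set_countable, ← Cardinal.succ_aleph0, Order.lt_succ_iff]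

theorem not_countable_of_mk_eq_aleph_one {S : Type*} {A : Set S}
    (h : Cardinal.mk A = Cardinal.aleph 1) : ¬ A.Countable := fun hc =>
  absurd ((countable_iff_mk_lt_aleph_one A).1 hc) (by rw [h]; exact lt_irrefl _)

theorem mk_eq_aleph_one_of_not_countable {S : Type*} (hS : Cardinal.mk S = Cardinal.aleph 1)
    {A : Set S} (h : ¬ A.Countable) : Cardinal.mk A = Cardinal.aleph 1 :=
  le_antisymm (hS ▸ Cardinal.mk_set_le A)
    (not_lt.1 fun hl => h ((countable_iff_mk_lt_aleph_one A).2 hl))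

theorem ADOn.countable_inter {S : Type*} {X : Set S} {𝒜 : Set (Set S)} (h : ADOn X 𝒜)
    {A B : Set S} (hA : A ∈ 𝒜) (hB : B ∈ 𝒜) (hne : A ≠ B) : (A ∩ B).Countable :=
  (countable_iff_mk_lt_aleph_one _).2 (h.2 A hA B hB hne)

/-- Every set of cardinality `ℵ₁` has uncountable intersection with some member of a MAD family. -/
theorem MADOn.exists_not_countable_inter {S : Type*} {X : Set S} {𝒜 : Set (Set S)}
    (h : MADOn X 𝒜) {Z : Set S} (hZX : Z ⊆ X) (hZ : Cardinal.mk Z = Cardinal.aleph 1) :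
    ∃ p ∈ 𝒜, ¬ (Z ∩ p).Countable := by
  by_contra! hcon
  have hlt : ∀ p ∈ 𝒜, Cardinal.mk (↥(Z ∩ p)) < Cardinal.aleph 1 := fun p hp =>
    (countable_iff_mk_lt_aleph_one _).1 (hcon p hp)
  have hAD : ADOn X (insert Z 𝒜) := by
    refine ⟨?_, ?_⟩
    · rintro A (rfl | hA)
      exacts [⟨hZX, hZ⟩, h.1.1 A hA]
    · rintro A (rfl | hA) B (rfl | hB) hne
      · exact absurd rfl hne
      · exact hlt B hB
      · rw [inter_comm]
        exact hlt A hA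
      · exact h.1.2 A hA B hB hne
  have hmem : Z ∈ 𝒜 := h.2 _ hAD (subset_insert _ _) ▸ mem_insert Z 𝒜
  have hc := hcon Z hmem
  rw [inter_self] at hc
  exact not_countable_of_mk_eq_aleph_one hZ hc

/-- The trace of `𝒜₁` on the complement of `⋃₀ 𝒜₂` is MAD when `𝒜₁ ∪ 𝒜₂` is. -/
theorem MADOn.traceFam_compl_sUnion {S : Type*} (hS : Cardinal.mk S = Cardinal.aleph 1)
    {𝒜₁ 𝒜₂ : Set (Set S)} (h : MADOn univ (𝒜₁ ∪ 𝒜₂)) :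
    MADOn (⋃₀ 𝒜₂)ᶜ (traceFam 𝒜₁ (⋃₀ 𝒜₂)ᶜ) := by
  refine ⟨⟨?_, ?_⟩, ?_⟩
  · rintro _ ⟨p, -, hp, rfl⟩
    exact ⟨inter_subset_left, mk_eq_aleph_one_of_not_countable hS hp⟩
  · rintro _ ⟨p, hp, -, rfl⟩ _ ⟨q, hq, -, rfl⟩ hne
    refine (countable_iff_mk_lt_aleph_one _).1 ?_
    refine (h.1.countable_inter (Or.inl hp) (Or.inl hq) ?_).mono
      (inter_subset_inter inter_subset_right inter_subset_right)
    rintro rfl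
    exact hne rfl
  · refine fun ℬ hℬ hsub => Subset.antisymm (fun Z hZ => ?_) hsub
    obtain ⟨hZY, hZcard⟩ := hℬ.1 Z hZ
    obtain ⟨p, hp, hZp⟩ := h.exists_not_countable_inter (subset_univ Z) hZcard
    have hp₁ : p ∈ 𝒜₁ := hp.resolve_right fun hp₂ => hZp <| by
      convert countable_empty
      exact eq_empty_of_forall_notMem fun x hx => hZY hx.1 ⟨p, hp₂, hx.2⟩
    have hmem : (⋃₀ 𝒜₂)ᶜ ∩ p ∈ traceFam 𝒜₁ (⋃₀ 𝒜₂)ᶜ :=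
      ⟨p, hp₁, fun hc => hZp (hc.mono (inter_subset_inter_left p hZY)), rfl⟩
    by_contra hnot
    refine hZp ((hℬ.countable_inter hZ (hsub hmem) fun he => hnot (he ▸ hmem)).mono ?_)
    exact fun x hx => ⟨hx.1, hZY hx.1, hx.2⟩

/-- Let  be a MAD family on a set of cardinality ℵ₁, partitioned into 
with  nowhere MAD of cardinality ℵ₁.  Then some  meets  in a set of
cardinality ℵ₁. -/
theorem statement17 (S : Type*) (hS : Cardinal.mk S = Cardinal.aleph 1)
    (𝒜 𝒜₁ 𝒜₂ : Set (Set S))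
    (hMAD : MADOn Set.univ 𝒜)
    (hunion : 𝒜₁ ∪ 𝒜₂ = 𝒜) (hdisj : 𝒜₁ ∩ 𝒜₂ = ∅)
    (hnm : NowhereMADOn Set.univ 𝒜₁)
    (hcard : Cardinal.mk 𝒜₁ = Cardinal.aleph 1) :
    ∃ A ∈ 𝒜₁, Cardinal.mk (↥(A ∩ ⋃₀ 𝒜₂)) = Cardinal.aleph 1 := by
  by_contra! hcon
  subst hunion
  have hcount : ∀ A ∈ 𝒜₁, (A ∩ ⋃₀ 𝒜₂).Countable := fun A hA => by
    by_contra hc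
    exact hcon A hA (mk_eq_aleph_one_of_not_countable hS hc)
  have hunc : ∀ A ∈ 𝒜₁, ¬ A.Countable := fun A hA =>
    not_countable_of_mk_eq_aleph_one (hMAD.1.1 A (Or.inl hA)).2
  have h𝒜₁ : ¬ 𝒜₁.Countable := not_countable_of_mk_eq_aleph_one hcard
  have hY : ¬ (⋃₀ 𝒜₂)ᶜ.Countable := fun hY => by
    obtain ⟨A, hA⟩ : 𝒜₁.Nonempty := nonempty_iff_ne_empty.2 fun he =>
      h𝒜₁ (he ▸ countable_empty)
    refine hunc A hA (((hcount A hA).union hY).mono fun x hx => ?_)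
    by_cases hx₂ : x ∈ ⋃₀ 𝒜₂
    exacts [Or.inl ⟨hx, hx₂⟩, Or.inr hx₂]
  obtain ⟨ℱ, hℱ, hℱc, hdiff⟩ := hnm _ (subset_univ _) hY (hMAD.traceFam_compl_sUnion hS)
  obtain ⟨A, hA, hAℱ⟩ : ∃ A ∈ 𝒜₁, A ∉ ℱ := not_subset.1 fun hs => h𝒜₁ (hℱc.mono hs)
  have hAint : (⋃ F ∈ ℱ, A ∩ F).Countable := hℱc.biUnion fun F hF =>
    hMAD.1.countable_inter (Or.inl hA) (Or.inl (hℱ hF)) fun he => hAℱ (he ▸ hF)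
  refine hunc A hA (((hcount A hA).union (hdiff.union hAint)).mono fun x hx => ?_)
  by_cases hx₂ : x ∈ ⋃₀ 𝒜₂
  · exact Or.inl ⟨hx, hx₂⟩
  by_cases hxℱ : x ∈ ⋃₀ ℱ
  · obtain ⟨F, hF, hxF⟩ := hxℱ
    exact Or.inr (Or.inr (mem_biUnion hF ⟨hx, hxF⟩))
  · exact Or.inr (Or.inl ⟨hx₂, hxℱ⟩)
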